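/- There exists a constant δ₀ = δ₀(n,p,m,Q,λ,Λ) > 0, independent of ε, with the following property: for every ε > 0 there exists ρ₀ = ρ₀(n,p,m,Q,λ,Λ,ε) > 0 such that if u is a Q-minimizer of J on Ω and |{u ≥ 0} ∩ B_ρ| ≥ ε·ρ^n for some ρ ≥ ρ₀ with B_ρ ⊆ Ω, then there exists R₁ = R₁(n,p,m,Q,λ,Λ,ε,ρ) such that |{u ≥ 0} ∩ B_R| ≥ δ₀·R^n for every R ≥ R₁ with B_R ⊆ Ω. -/

import Mathlib

open MeasureTheory Metric Set

noncomputable section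

/-- `v` is locally Lipschitz at every point of `Ω`. -/
def LocLipOn {n : ℕ} (Ω : Set (EuclideanSpace ℝ (Fin n)))
    (v : EuclideanSpace ℝ (Fin n) → ℝ) : Prop :=
  ∀ x ∈ Ω, ∃ K : NNReal, ∃ U ∈ nhds x, LipschitzOnWith K v U

/-- The Ginzburg–Landau type energy `J(v,A) = ∫_A E(∇v, v, x) dx`. -/
def Jen {n : ℕ} (Efun : EuclideanSpace ℝ (Fin n) → ℝ → EuclideanSpace ℝ (Fin n) → ℝ)
    (v : EuclideanSpace ℝ (Fin n) → ℝ) (A : Set (EuclideanSpace ℝ (Fin n))) : ℝ :=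
  ∫ x in A, Efun (gradient v x) (v x) x

/-- `u` is a `Q`-minimizer of the energy `Jen Efun` in `Ω`. -/
def IsQMin {n : ℕ} (Q : ℝ) (Ω : Set (EuclideanSpace ℝ (Fin n)))
    (Efun : EuclideanSpace ℝ (Fin n) → ℝ → EuclideanSpace ℝ (Fin n) → ℝ)
    (u : EuclideanSpace ℝ (Fin n) → ℝ) : Prop :=
  ∀ Ω' : Set (EuclideanSpace ℝ (Fin n)), IsOpen Ω' → Bornology.IsBounded Ω' →
    closure Ω' ⊆ Ω →
    ∀ v : EuclideanSpace ℝ (Fin n) → ℝ,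
      (∀ x, v x ∈ Icc (-1 : ℝ) 1) → LocLipOn Ω v →
      (∀ x ∈ Ω \ Ω', v x = u x) →
      Jen Efun u Ω' ≤ Q * Jen Efun v Ω'

open scoped ENNReal in
theorem enorm_le_lintegral_enorm_deriv_of_lipschitz {f : ℝ → ℝ} {K : NNReal}
    (hf : LipschitzWith K f) (hc : HasCompactSupport f) (x : ℝ) :
    ‖f x‖ₑ ≤ ∫⁻ t, ‖deriv f t‖ₑ := by
  obtain ⟨a, hax, ha⟩ : ∃ a ≤ x, f a = 0 := by
    obtain ⟨b, hb⟩ := hc.isCompact.isBounded.bddBelow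
    refine ⟨min x (b - 1), min_le_left _ _, image_eq_zero_of_notMem_tsupport fun h ↦ ?_⟩
    have := hb h
    have := min_le_right x (b - 1)
    linarith
  have h := (hf.lipschitzOnWith (s := uIcc a x)).absolutelyContinuousOnInterval.integral_deriv_eq_sub
  rw [ha, sub_zero] at h
  rw [← h, intervalIntegral.integral_of_le hax]
  exact (enorm_integral_le_lintegral_enorm _).trans (lintegral_mono' Measure.restrict_le_self le_rfl)

open scoped ENNReal in
/-- The **Gagliardo-Nirenberg-Sobolev inequality** for compactly supported Lipschitz functions
on `ι → ℝ`, in terms of the partial derivatives. -/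
theorem lintegral_pow_le_pow_lintegral_lineDeriv {ι : Type*} [Fintype ι] [DecidableEq ι]
    {q : ℝ} (hq : Real.HolderConjugate (Fintype.card ι) q)
    {u : (ι → ℝ) → ℝ} {K : NNReal} (hu : LipschitzWith K u) (h2u : HasCompactSupport u) :
    ∫⁻ x, ‖u x‖ₑ ^ q ≤ (∫⁻ x, ∑ i, ‖lineDeriv ℝ u x (Pi.single i 1)‖ₑ) ^ q := by
  have hcard : (1 : ℝ) ≤ (Fintype.card ι : ℝ) - 1 := by
    have hι : (2 : ℝ) ≤ Fintype.card ι := by exact_mod_cast hq.lt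
    linarith
  set g : (ι → ℝ) → ℝ≥0∞ := fun x ↦ ∑ i, ‖lineDeriv ℝ u x (Pi.single i 1)‖ₑ with hg
  have hgm : Measurable g :=
    Finset.measurable_sum _ fun i _ ↦ (measurable_lineDeriv hu.continuous).enorm
  calc ∫⁻ x, ‖u x‖ₑ ^ q
      = ∫⁻ x, (‖u x‖ₑ ^ (1 / (Fintype.card ι - 1 : ℝ))) ^ (Fintype.card ι : ℝ) := by
        congr! 2 with x
        rw [← ENNReal.rpow_mul, hq.conjugate_eq]
        field_simp
    _ = ∫⁻ x, ∏ _i : ι, ‖u x‖ₑ ^ (1 / (Fintype.card ι - 1 : ℝ)) := by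
        congr! 2 with x
        simp_rw [Finset.prod_const]
        norm_cast
    _ ≤ ∫⁻ x, ∏ i, (∫⁻ t, g (Function.update x i t)) ^ ((1 : ℝ) / (Fintype.card ι - 1 : ℝ)) := by
        gcongr with x i
        have hupd : LipschitzWith 1 (Function.update x i) := by
          refine LipschitzWith.of_dist_le_mul fun s t ↦ ?_
          simp only [NNReal.coe_one, one_mul]
          refine (dist_pi_le_iff dist_nonneg).2 fun j ↦ ?_
          by_cases hj : j = i
          · subst hj; simp
          · simp [Function.update_of_ne hj]
        have h1 := enorm_le_lintegral_enorm_deriv_of_lipschitz (f := u ∘ Function.update x i)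
          (hu.comp hupd)
          (h2u.comp_isClosedEmbedding (isClosedEmbedding_update x i)) (x i)
        refine le_trans (by simpa using h1) (lintegral_mono fun t ↦ ?_)
        have h2 : deriv (u ∘ Function.update x i) t
            = lineDeriv ℝ u (Function.update x i t) (Pi.single i 1) := by
          have : (fun s : ℝ ↦ u (Function.update x i t + s • Pi.single i 1))
              = fun s ↦ (u ∘ Function.update x i) (t + s) := by
            funext s
            simp only [Function.comp_apply]
            congr 1
            ext j
            by_cases hj : j = i
            · subst hj; simp
            · simp [Function.update_of_ne hj, Pi.single_eq_of_ne hj]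
          rw [lineDeriv, this, deriv_comp_const_add, add_zero]
        rw [h2]
        exact Finset.single_le_sum
          (f := fun j ↦ ‖lineDeriv ℝ u (Function.update x i t) (Pi.single j 1)‖ₑ)
          (fun _ _ ↦ zero_le) (Finset.mem_univ i)
    _ ≤ (∫⁻ x, g x) ^ q := lintegral_prod_lintegral_pow_le _ hq hgm

open scoped ENNReal in
theorem lintegral_pow_le_pow_lintegral_of_enorm_lineDeriv_le {n : ℕ} {q : ℝ}
    (hq : Real.HolderConjugate n q) {w : EuclideanSpace ℝ (Fin n) → ℝ} {K : NNReal}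
    (hw : LipschitzWith K w) (h2w : HasCompactSupport w) {F : EuclideanSpace ℝ (Fin n) → ℝ≥0∞}
    (hF : ∀ᵐ x, ∀ v : EuclideanSpace ℝ (Fin n), ‖v‖ = 1 → ‖lineDeriv ℝ w x v‖ₑ ≤ F x) :
    ∫⁻ x, ‖w x‖ₑ ^ q ≤ (n * ∫⁻ x, F x) ^ q := by
  have hmp := EuclideanSpace.volume_preserving_symm_measurableEquiv_toLp (Fin n)
  set e := (MeasurableEquiv.toLp 2 (Fin n → ℝ)) with he
  have hmp' : MeasurePreserving e := by
    simpa using hmp.symm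
  have hlip : LipschitzWith (K * _) (w ∘ e) := hw.comp (PiLp.lipschitzWith_toLp 2 _)
  have hcs : HasCompactSupport (w ∘ e) :=
    h2w.comp_homeomorph (PiLp.homeomorph 2 (fun _ : Fin n ↦ ℝ)).symm
  have h1 := lintegral_pow_le_pow_lintegral_lineDeriv (q := q) (by simpa using hq) hlip hcs
  rw [← hmp'.lintegral_comp_emb e.measurableEmbedding]
  refine h1.trans ?_
  have hq0 : 0 ≤ q := hq.symm.nonneg
  gcongr
  rw [← hmp'.lintegral_comp_emb e.measurableEmbedding, ← lintegral_const_mul']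
  swap
  · simp
  refine lintegral_mono_ae ?_
  filter_upwards [hmp'.quasiMeasurePreserving.ae hF] with x hx
  refine (Finset.sum_le_card_nsmul _ _ (F (e x)) fun i _ ↦ ?_).trans (by simp)
  exact hx (WithLp.toLp 2 (Pi.single i 1)) (by simp)

theorem LocLipOn.exists_lipschitzOnWith {n : ℕ} {Ω K : Set (EuclideanSpace ℝ (Fin n))}
    {u : EuclideanSpace ℝ (Fin n) → ℝ} (hu : LocLipOn Ω u) (hK : IsCompact K) (hKΩ : K ⊆ Ω) :
    ∃ C, LipschitzOnWith C u K := by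
  refine LocallyLipschitzOn.exists_lipschitzOnWith_of_compact hK fun x hx ↦ ?_
  obtain ⟨C, U, hU, h⟩ := hu x (hKΩ hx)
  exact ⟨C, U, mem_nhdsWithin_of_mem_nhds hU, h⟩

theorem LocLipOn.min {n : ℕ} {Ω : Set (EuclideanSpace ℝ (Fin n))}
    {u v : EuclideanSpace ℝ (Fin n) → ℝ} (hu : LocLipOn Ω u) {C : NNReal} (hv : LipschitzWith C v) :
    LocLipOn Ω (fun x ↦ min (u x) (v x)) := by
  intro x hx
  obtain ⟨K, U, hU, h⟩ := hu x hx
  refine ⟨max K C, U, hU, LipschitzOnWith.of_dist_le_mul fun y hy z hz ↦ ?_⟩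
  have h1 := h.dist_le_mul y hy z hz
  have h2 := hv.dist_le_mul y z
  rw [Real.dist_eq] at *
  refine (abs_min_sub_min_le_max _ _ _ _).trans (max_le ?_ ?_)
  · exact h1.trans (by gcongr; exact le_max_left _ _)
  · exact h2.trans (by gcongr; exact le_max_right _ _)

theorem norm_gradient {n : ℕ} (u : EuclideanSpace ℝ (Fin n) → ℝ) (x : EuclideanSpace ℝ (Fin n)) :
    ‖gradient u x‖ = ‖fderiv ℝ u x‖ := by
  simp [gradient]

theorem measurable_gradient {n : ℕ} (u : EuclideanSpace ℝ (Fin n) → ℝ) :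
    Measurable (gradient u) :=
  (InnerProductSpace.toDual ℝ (EuclideanSpace ℝ (Fin n))).symm.continuous.measurable.comp
    (measurable_fderiv ℝ u)

theorem norm_gradient_le_of_lipschitzOnWith {n : ℕ} {u : EuclideanSpace ℝ (Fin n) → ℝ}
    {K : Set (EuclideanSpace ℝ (Fin n))} {C : NNReal} (hu : LipschitzOnWith C u K)
    {x : EuclideanSpace ℝ (Fin n)} (hx : K ∈ nhds x) : ‖gradient u x‖ ≤ C := by
  rw [norm_gradient]
  exact norm_fderiv_le_of_lipschitzOn ℝ hx hu

/-- The part of the energy density that is controlled from below. -/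
def lowerDensity {n : ℕ} (p m : ℝ) (u : EuclideanSpace ℝ (Fin n) → ℝ)
    (x : EuclideanSpace ℝ (Fin n)) : ℝ :=
  ‖gradient u x‖ ^ p + |u x + 1| ^ m * (if u x ≤ 0 then (1 : ℝ) else 0)

/-- Two-sided growth of the energy density on `Ω`. -/
def EnergyGrowth {n : ℕ} (p m lam Lam : ℝ) (Ω : Set (EuclideanSpace ℝ (Fin n)))
    (Efun : EuclideanSpace ℝ (Fin n) → ℝ → EuclideanSpace ℝ (Fin n) → ℝ) : Prop :=
  ∀ ξ τ x, τ ∈ Icc (-1 : ℝ) 1 → x ∈ Ω →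
    0 ≤ Efun ξ τ x ∧
    lam * (‖ξ‖ ^ p + |τ + 1| ^ m * (if τ ≤ 0 then (1 : ℝ) else 0)) ≤ Efun ξ τ x ∧
    Efun ξ τ x ≤ Lam * (‖ξ‖ ^ p + |τ + 1| ^ m)

theorem lintegral_lowerDensity_le_of_Jen_le {n : ℕ} {p m Q lam Lam : ℝ}
    (hp : 0 ≤ p) (hm : 0 ≤ m) (hQ : 0 ≤ Q) (hlam : 0 < lam) (hLam : 0 ≤ Lam)
    {Ω D : Set (EuclideanSpace ℝ (Fin n))}
    {Efun : EuclideanSpace ℝ (Fin n) → ℝ → EuclideanSpace ℝ (Fin n) → ℝ}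
    (hEm : Measurable (fun q : EuclideanSpace ℝ (Fin n) × ℝ × EuclideanSpace ℝ (Fin n) =>
          Efun q.1 q.2.1 q.2.2))
    (hE : EnergyGrowth p m lam Lam Ω Efun)
    {u v : EuclideanSpace ℝ (Fin n) → ℝ} (hu : ∀ x, u x ∈ Icc (-1 : ℝ) 1)
    (hv : ∀ x, v x ∈ Icc (-1 : ℝ) 1) (hD : MeasurableSet D) (hDvol : volume D ≠ ⊤) (hDΩ : D ⊆ Ω)
    (huc : ContinuousOn u D) {C : ℝ} (hC : ∀ x ∈ D, ‖gradient u x‖ ≤ C)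
    (hJ : Jen Efun u D ≤ Q * Jen Efun v D) :
    ∫⁻ x in D, ENNReal.ofReal (lowerDensity p m u x) ≤
      ENNReal.ofReal (Q * Lam / lam) *
        ∫⁻ x in D, ENNReal.ofReal (‖gradient v x‖ ^ p + |v x + 1| ^ m) := by
  have hInt : IntegrableOn (fun x ↦ Efun (gradient u x) (u x) x) D := by
    have : IsFiniteMeasure (volume.restrict D) := isFiniteMeasure_restrict.2 hDvol
    refine Integrable.of_bound ?_ (Lam * (C ^ p + 2 ^ m)) ?_
    · have : AEMeasurable (fun x ↦ (gradient u x, u x, x)) (volume.restrict D) :=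
        (measurable_gradient u).aemeasurable.prodMk
          ((huc.aemeasurable hD).prodMk measurable_id.aemeasurable)
      exact (hEm.comp_aemeasurable this).aestronglyMeasurable
    · refine (ae_restrict_iff' hD).2 (Filter.Eventually.of_forall fun x hx ↦ ?_)
      obtain ⟨h0, -, h2⟩ := hE (gradient u x) (u x) x (hu x) (hDΩ hx)
      rw [Real.norm_of_nonneg h0]
      refine h2.trans ?_
      have h3 := hu x
      have : |u x + 1| ≤ 2 := by rw [abs_le]; constructor <;> linarith [h3.1, h3.2]
      have := hC x hx
      gcongr
  have hlow : ENNReal.ofReal lam * ∫⁻ x in D, ENNReal.ofReal (lowerDensity p m u x) ≤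
      ENNReal.ofReal (Jen Efun u D) := by
    rw [Jen, ofReal_integral_eq_lintegral_ofReal hInt ((ae_restrict_iff' hD).2
      (Filter.Eventually.of_forall fun x hx ↦ (hE _ _ x (hu x) (hDΩ hx)).1)),
      ← lintegral_const_mul' _ _ ENNReal.ofReal_ne_top]
    refine setLIntegral_mono' hD fun x hx ↦ ?_
    rw [← ENNReal.ofReal_mul hlam.le]
    exact ENNReal.ofReal_le_ofReal (hE _ _ x (hu x) (hDΩ hx)).2.1
  have hup : ENNReal.ofReal (Jen Efun v D) ≤ ENNReal.ofReal Lam *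
      ∫⁻ x in D, ENNReal.ofReal (‖gradient v x‖ ^ p + |v x + 1| ^ m) := by
    have h1 : ENNReal.ofReal (Jen Efun v D) ≤
        ∫⁻ x in D, ‖Efun (gradient v x) (v x) x‖ₑ := by
      rw [Jen]
      refine le_trans ?_ (enorm_integral_le_lintegral_enorm _)
      rw [Real.enorm_eq_ofReal_abs]
      exact ENNReal.ofReal_le_ofReal (le_abs_self _)
    rw [← lintegral_const_mul' _ _ ENNReal.ofReal_ne_top]
    refine h1.trans (setLIntegral_mono' hD fun x hx ↦ ?_)
    obtain ⟨h0, -, h2⟩ := hE (gradient v x) (v x) x (hv x) (hDΩ hx)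
    rw [Real.enorm_eq_ofReal h0, ← ENNReal.ofReal_mul hLam]
    exact ENNReal.ofReal_le_ofReal h2
  have hlam' : ENNReal.ofReal lam ≠ 0 := by simpa using hlam
  rw [← ENNReal.mul_le_mul_iff_right hlam' ENNReal.ofReal_ne_top]
  refine hlow.trans ((ENNReal.ofReal_le_ofReal hJ).trans ?_)
  rw [ENNReal.ofReal_mul hQ, ← mul_assoc, ← ENNReal.ofReal_mul hlam.le]
  have : lam * (Q * Lam / lam) = Q * Lam := by field_simp
  rw [this, ENNReal.ofReal_mul hQ, mul_assoc]
  gcongr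

/-- One-dimensional barrier: steep on `[0, 1]`, then of height at most `s` with slope `s / L`,
and zero beyond `L`. -/
def barrier (s L t : ℝ) : ℝ := max (max 0 (2 - 2 * t)) (s * (1 - t / L))

section barrier

variable {s L t : ℝ}

theorem barrier_nonneg : 0 ≤ barrier s L t := le_max_of_le_left (le_max_left _ _)

theorem two_le_barrier (ht : t ≤ 0) : 2 ≤ barrier s L t :=
  le_max_of_le_left (le_max_of_le_right (by linarith))

theorem barrier_of_one_le (ht : 1 ≤ t) : barrier s L t = max 0 (s * (1 - t / L)) := by
  rw [barrier, max_eq_left (a := (0 : ℝ)) (by linarith)]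

theorem barrier_le (hs : 0 ≤ s) (hL : 0 < L) (ht : 1 ≤ t) : barrier s L t ≤ s := by
  rw [barrier_of_one_le ht]
  refine max_le hs ?_
  have : 0 ≤ t / L := by positivity
  nlinarith

theorem barrier_lt (hs : 0 < s) (hL : 0 < L) (ht : 1 ≤ t) : barrier s L t < s := by
  rw [barrier_of_one_le ht]
  refine max_lt hs ?_
  have : 0 < t / L := by positivity
  nlinarith

theorem barrier_eq_zero (hs : 0 ≤ s) (hL : 1 ≤ L) (ht : L ≤ t) : barrier s L t = 0 := by
  rw [barrier_of_one_le (hL.trans ht)]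
  refine max_eq_left (mul_nonpos_of_nonneg_of_nonpos hs ?_)
  have : 1 ≤ t / L := by rwa [le_div_iff₀ (by linarith), one_mul]
  linarith

theorem half_le_barrier (hs : 0 ≤ s) (hL : 2 ≤ L) (ht : t ≤ 1) : s / 2 ≤ barrier s L t := by
  refine le_max_of_le_right ?_
  have : t / L ≤ 1 / 2 := by
    rw [div_le_div_iff₀ (by linarith) two_pos]
    linarith
  nlinarith

theorem lipschitzWith_barrier (hs : 0 ≤ s) (hs1 : s ≤ 1) (hL : 1 ≤ L) :
    LipschitzWith 2 (barrier s L) := by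
  refine LipschitzWith.of_dist_le_mul fun t t' ↦ ?_
  have hsL : s / L ≤ 2 := by
    rw [div_le_iff₀ (by linarith)]; linarith
  have hsL0 : 0 ≤ s / L := by positivity
  simp only [Real.dist_eq, NNReal.coe_ofNat, barrier]
  have h1 : |(2 - 2 * t) - (2 - 2 * t')| = 2 * |t - t'| := by
    rw [show (2 - 2 * t) - (2 - 2 * t') = -(2 * (t - t')) by ring, abs_neg, abs_mul]
    norm_num
  have h2 : |s * (1 - t / L) - s * (1 - t' / L)| = s / L * |t - t'| := by
    rw [show s * (1 - t / L) - s * (1 - t' / L) = -(s / L * (t - t')) by ring, abs_neg, abs_mul,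
      abs_of_nonneg hsL0]
  have h3 := abs_nonneg (t - t')
  refine (abs_max_sub_max_le_max _ _ _ _).trans (max_le ?_ ?_)
  · refine (abs_max_sub_max_le_max _ _ _ _).trans (max_le ?_ h1.le)
    simp
  · rw [h2]; gcongr

theorem abs_barrier_sub_barrier_le (hs : 0 ≤ s) (hL : 1 ≤ L) {t' : ℝ} (ht : 1 ≤ t) (ht' : 1 ≤ t') :
    |barrier s L t - barrier s L t'| ≤ s / L * |t - t'| := by
  have hsL0 : 0 ≤ s / L := by positivity
  rw [barrier_of_one_le ht, barrier_of_one_le ht']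
  have h2 : |s * (1 - t / L) - s * (1 - t' / L)| = s / L * |t - t'| := by
    rw [show s * (1 - t / L) - s * (1 - t' / L) = -(s / L * (t - t')) by ring, abs_neg, abs_mul,
      abs_of_nonneg hsL0]
  refine (abs_max_sub_max_le_max _ _ _ _).trans (max_le ?_ h2.le)
  simp only [sub_self, abs_zero]
  positivity

end barrier

/-- The radial competitor with boundary layer inside the ball of radius `r`. -/
def radialBarrier {n : ℕ} (s L r : ℝ) (x : EuclideanSpace ℝ (Fin n)) : ℝ :=
  barrier s L (r - ‖x‖) - 1

theorem lipschitzWith_radialBarrier {n : ℕ} {s L r : ℝ} (hs : 0 ≤ s) (hs1 : s ≤ 1) (hL : 1 ≤ L) :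
    LipschitzWith 2 (radialBarrier (n := n) s L r) := by
  refine LipschitzWith.of_dist_le_mul fun x y ↦ ?_
  have h := (lipschitzWith_barrier hs hs1 hL).dist_le_mul (r - ‖x‖) (r - ‖y‖)
  rw [Real.dist_eq] at *
  simp only [radialBarrier, sub_sub_sub_cancel_right]
  refine h.trans ?_
  gcongr
  rw [Real.dist_eq, sub_sub_sub_cancel_left, abs_sub_comm, dist_eq_norm]
  exact abs_norm_sub_norm_le x y

theorem norm_gradient_radialBarrier_le_two {n : ℕ} {s L r : ℝ} (hs : 0 ≤ s) (hs1 : s ≤ 1)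
    (hL : 1 ≤ L) (x : EuclideanSpace ℝ (Fin n)) : ‖gradient (radialBarrier s L r) x‖ ≤ 2 :=
  norm_gradient_le_of_lipschitzOnWith (lipschitzWith_radialBarrier hs hs1 hL).lipschitzOnWith
    Filter.univ_mem

theorem norm_gradient_radialBarrier_le {n : ℕ} {s L r : ℝ} (hs : 0 ≤ s)
    (hL : 1 ≤ L) {x : EuclideanSpace ℝ (Fin n)} (hx : ‖x‖ < r - 1) :
    ‖gradient (radialBarrier s L r) x‖ ≤ s / L := by
  rw [norm_gradient]
  refine norm_fderiv_le_of_lip' ℝ (by positivity) ?_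
  filter_upwards [(isOpen_lt continuous_norm continuous_const).mem_nhds hx] with y hy
  rw [Real.norm_eq_abs]
  simp only [radialBarrier, sub_sub_sub_cancel_right]
  refine (abs_barrier_sub_barrier_le hs hL (by linarith) (by linarith)).trans ?_
  gcongr
  rw [sub_sub_sub_cancel_left, abs_sub_comm]
  exact abs_norm_sub_norm_le y x

theorem gradient_radialBarrier_eq_zero {n : ℕ} {s L r : ℝ} (hs : 0 ≤ s) (hL : 1 ≤ L)
    {x : EuclideanSpace ℝ (Fin n)} (hx : ‖x‖ < r - L) :
    gradient (radialBarrier s L r) x = 0 := by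
  rw [← norm_eq_zero, norm_gradient, norm_eq_zero]
  have : radialBarrier s L r =ᶠ[nhds x] fun _ ↦ (-1 : ℝ) := by
    filter_upwards [(isOpen_lt continuous_norm continuous_const).mem_nhds hx] with y hy
    rw [radialBarrier, barrier_eq_zero hs hL (by linarith), zero_sub]
  rw [this.fderiv_eq]
  simp

/-- The region in the ball of radius `r` where `u` exceeds the radial barrier. -/
def exceedSet {n : ℕ} (s L r : ℝ) (u : EuclideanSpace ℝ (Fin n) → ℝ) :
    Set (EuclideanSpace ℝ (Fin n)) :=
  ball 0 r ∩ {x | radialBarrier s L r x < u x}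

theorem isOpen_exceedSet {n : ℕ} {s L r : ℝ} {u : EuclideanSpace ℝ (Fin n) → ℝ}
    (hs : 0 ≤ s) (hs1 : s ≤ 1) (hL : 1 ≤ L) (hu : ContinuousOn u (ball 0 r)) :
    IsOpen (exceedSet s L r u) := by
  have h := (hu.sub (lipschitzWith_radialBarrier (n := n) (r := r) hs hs1
    hL).continuous.continuousOn).isOpen_inter_preimage isOpen_ball (isOpen_Ioi (a := (0 : ℝ)))
  convert! h using 2
  ext x
  simp [exceedSet]

/-- Comparison of a `Q`-minimizer with the radial barrier. -/
theorem lintegral_lowerDensity_exceedSet_le {n : ℕ} {p m Q lam Lam : ℝ}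
    (hp : 1 < p) (hpm : p < m) (hQ : 1 ≤ Q) (hlam : 0 < lam) (hlL : lam ≤ Lam)
    {Ω : Set (EuclideanSpace ℝ (Fin n))}
    {Efun : EuclideanSpace ℝ (Fin n) → ℝ → EuclideanSpace ℝ (Fin n) → ℝ}
    (hEm : Measurable (fun q : EuclideanSpace ℝ (Fin n) × ℝ × EuclideanSpace ℝ (Fin n) =>
          Efun q.1 q.2.1 q.2.2))
    (hE : EnergyGrowth p m lam Lam Ω Efun)
    {u : EuclideanSpace ℝ (Fin n) → ℝ} (hu : ∀ x, u x ∈ Icc (-1 : ℝ) 1) (huL : LocLipOn Ω u)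
    (huQ : IsQMin Q Ω Efun u) {r s L : ℝ} (hr : closedBall 0 r ⊆ Ω) (hs : 0 < s) (hs1 : s ≤ 1)
    (hL : 1 ≤ L) :
    ∫⁻ x in exceedSet s L r u, ENNReal.ofReal (lowerDensity p m u x) ≤
      ENNReal.ofReal (Q * Lam / lam) *
        (ENNReal.ofReal (2 ^ p + 2 ^ m) *
            volume (exceedSet s L r u ∩ (ball 0 r \ ball 0 (r - 1))) +
          ENNReal.ofReal ((s / L) ^ p + s ^ m) *
            volume (ball (0 : EuclideanSpace ℝ (Fin n)) r \ ball 0 (r - L))) := by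
  set D := exceedSet s L r u with hDdef
  have hp0 : 0 < p := by linarith
  have hm0 : 0 < m := by linarith
  obtain ⟨K, hK⟩ := huL.exists_lipschitzOnWith (isCompact_closedBall 0 r) hr
  have hDball : D ⊆ ball 0 r := inter_subset_left
  have hDclosed : closure D ⊆ closedBall 0 r :=
    (closure_mono hDball).trans closure_ball_subset_closedBall
  have huc : ContinuousOn u (ball 0 r) := hK.continuousOn.mono ball_subset_closedBall
  have hDo : IsOpen D := isOpen_exceedSet hs.le hs1 hL huc
  set v : EuclideanSpace ℝ (Fin n) → ℝ := fun x ↦ min (u x) (radialBarrier s L r x) with hvdef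
  have hv : ∀ x, v x ∈ Icc (-1 : ℝ) 1 := fun x ↦
    ⟨le_min (hu x).1 ((neg_le_sub_iff_le_add).2 (by simp [barrier_nonneg])),
      (min_le_left _ _).trans (hu x).2⟩
  have hvu : ∀ x ∉ D, v x = u x := by
    intro x hx
    refine min_eq_left ?_
    by_cases hxr : x ∈ ball 0 r
    · by_contra! h
      exact hx ⟨hxr, h⟩
    · rw [mem_ball_zero_iff, not_lt] at hxr
      have := two_le_barrier (s := s) (L := L) (t := r - ‖x‖) (by linarith)
      rw [radialBarrier]
      linarith [(hu x).2]
  have hJ := huQ D hDo (isBounded_ball.subset hDball) (hDclosed.trans hr) v hv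
    (huL.min (lipschitzWith_radialBarrier hs.le hs1 hL)) (fun x hx ↦ hvu x hx.2)
  refine (lintegral_lowerDensity_le_of_Jen_le hp0.le hm0.le (by linarith) hlam (by linarith)
    hEm hE hu hv hDo.measurableSet
    (ne_top_of_le_ne_top measure_ball_lt_top.ne (measure_mono hDball))
    (hDball.trans (ball_subset_closedBall.trans hr)) (huc.mono hDball) (C := K)
    (fun x hx ↦ norm_gradient_le_of_lipschitzOnWith hK
      (Filter.mem_of_superset (isOpen_ball.mem_nhds (hDball hx)) ball_subset_closedBall)) hJ).trans ?_
  gcongr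
  have hgrad : ∀ x ∈ D, gradient v x = gradient (radialBarrier s L r) x := by
    intro x hx
    have : v =ᶠ[nhds x] radialBarrier s L r := by
      filter_upwards [hDo.mem_nhds hx] with y hy
      exact min_eq_right hy.2.le
    simp only [gradient, this.fderiv_eq]
  have hv2 : ∀ x, |v x + 1| ≤ 2 := fun x ↦ by
    rw [abs_le]; constructor <;> linarith [(hv x).1, (hv x).2]
  set S : Set (EuclideanSpace ℝ (Fin n)) := ball 0 r \ ball 0 (r - 1)
  set T : Set (EuclideanSpace ℝ (Fin n)) := ball 0 r \ ball 0 (r - L)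
  have hS : MeasurableSet S := measurableSet_ball.diff measurableSet_ball
  have hT : MeasurableSet T := measurableSet_ball.diff measurableSet_ball
  have hpt : ∀ x ∈ D, ENNReal.ofReal (‖gradient v x‖ ^ p + |v x + 1| ^ m) ≤
      S.indicator (fun _ ↦ ENNReal.ofReal (2 ^ p + 2 ^ m)) x +
        T.indicator (fun _ ↦ ENNReal.ofReal ((s / L) ^ p + s ^ m)) x := by
    intro x hx
    have hxr := hDball hx
    by_cases h1 : x ∈ ball 0 (r - 1)
    · rw [mem_ball_zero_iff] at h1
      have hvx : v x = radialBarrier s L r x := min_eq_right hx.2.le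
      by_cases h2 : x ∈ ball 0 (r - L)
      · rw [mem_ball_zero_iff] at h2
        rw [hgrad x hx, gradient_radialBarrier_eq_zero hs.le hL h2, hvx, radialBarrier,
          barrier_eq_zero hs.le hL (by linarith)]
        simp [Real.zero_rpow hp0.ne', Real.zero_rpow hm0.ne']
      · refine le_add_left ?_
        rw [indicator_of_mem (show x ∈ T from ⟨hxr, h2⟩)]
        refine ENNReal.ofReal_le_ofReal ?_
        have h3 : ‖gradient v x‖ ≤ s / L := by
          rw [hgrad x hx]
          exact norm_gradient_radialBarrier_le hs.le hL h1
        have h4 : |v x + 1| ≤ s := by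
          rw [hvx, radialBarrier, sub_add_cancel, abs_of_nonneg barrier_nonneg]
          exact barrier_le hs.le (by linarith) (by linarith)
        gcongr
    · refine le_add_right ?_
      rw [indicator_of_mem (show x ∈ S from ⟨hxr, h1⟩)]
      refine ENNReal.ofReal_le_ofReal ?_
      have h3 : ‖gradient v x‖ ≤ 2 := by
        rw [hgrad x hx]
        exact norm_gradient_radialBarrier_le_two hs.le hs1 hL x
      have h4 := hv2 x
      gcongr
  refine (setLIntegral_mono' hDo.measurableSet hpt).trans ?_
  rw [lintegral_add_left (measurable_const.indicator hS), lintegral_indicator_const hS,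
    lintegral_indicator_const hT, Measure.restrict_apply hS, Measure.restrict_apply hT, inter_comm]
  gcongr
  exact inter_subset_left

/-- Truncation of `u` to the range `[-1/2, 0]`, cut off inside the ball of radius `r - 1`. -/
def cutoffTrunc {n : ℕ} (r : ℝ) (u : EuclideanSpace ℝ (Fin n) → ℝ)
    (x : EuclideanSpace ℝ (Fin n)) : ℝ :=
  max 0 (min (u x) 0 + 1 / 2 - max 0 (‖x‖ - (r - 2)))

section cutoffTrunc

variable {n : ℕ} {r : ℝ} {u : EuclideanSpace ℝ (Fin n) → ℝ} {x y : EuclideanSpace ℝ (Fin n)}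

theorem cutoffTrunc_nonneg : 0 ≤ cutoffTrunc r u x := le_max_left _ _

theorem cutoffTrunc_le : cutoffTrunc r u x ≤ 1 / 2 :=
  max_le (by norm_num)
    (by linarith [min_le_right (u x) 0, le_max_left 0 (‖x‖ - (r - 2))])

theorem cutoffTrunc_eq_zero_of_le_norm (hx : r - 3 / 2 ≤ ‖x‖) : cutoffTrunc r u x = 0 :=
  max_eq_left (by linarith [min_le_right (u x) 0, le_max_right 0 (‖x‖ - (r - 2))])

theorem cutoffTrunc_eq_zero_of_le (hx : u x ≤ -1 / 2) : cutoffTrunc r u x = 0 :=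
  max_eq_left (by linarith [min_le_left (u x) 0, le_max_left 0 (‖x‖ - (r - 2))])

theorem cutoffTrunc_eq_half (hx : ‖x‖ < r - 2) (hu : 0 ≤ u x) : cutoffTrunc r u x = 1 / 2 := by
  rw [cutoffTrunc, min_eq_right hu, max_eq_left (a := (0 : ℝ)) (b := ‖x‖ - (r - 2)) (by linarith)]
  norm_num

theorem abs_cutoffTrunc_sub_le :
    |cutoffTrunc r u y - cutoffTrunc r u x| ≤
      |min (u y) 0 - min (u x) 0| + |max 0 (‖y‖ - (r - 2)) - max 0 (‖x‖ - (r - 2))| := by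
  refine (abs_max_sub_max_le_max _ _ _ _).trans (max_le ?_ ?_)
  · simp only [sub_self, abs_zero]; positivity
  · rw [show ∀ a b c d : ℝ, a + 1 / 2 - b - (c + 1 / 2 - d) = (a - c) - (b - d) by intros; ring]
    exact abs_sub _ _

theorem abs_radial_sub_le :
    |max 0 (‖y‖ - (r - 2)) - max 0 (‖x‖ - (r - 2))| ≤ ‖y - x‖ := by
  refine (abs_max_sub_max_le_max _ _ _ _).trans (max_le (by simp) ?_)
  rw [sub_sub_sub_cancel_right]
  exact abs_norm_sub_norm_le y x

theorem abs_min_zero_sub_le (a b : ℝ) : |min a 0 - min b 0| ≤ |a - b| := by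
  simpa using abs_min_sub_min_le_max a 0 b 0

theorem exists_lipschitzWith_cutoffTrunc {K : NNReal}
    (hK : LipschitzOnWith K u (closedBall 0 r)) : ∃ C, LipschitzWith C (cutoffTrunc r u) := by
  have key : ∀ x y : EuclideanSpace ℝ (Fin n), ‖x‖ < r - 1 →
      |cutoffTrunc r u y - cutoffTrunc r u x| ≤ (K + 1) * ‖y - x‖ := by
    intro x y hx
    by_cases hy : ‖y‖ ≤ r
    · have h := hK.dist_le_mul y (by simpa using hy) x (by simp; linarith)
      rw [Real.dist_eq, dist_eq_norm] at h
      have := abs_min_zero_sub_le (u y) (u x)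
      linarith [abs_cutoffTrunc_sub_le (r := r) (u := u) (x := x) (y := y),
        abs_radial_sub_le (r := r) (x := x) (y := y)]
    · rw [cutoffTrunc_eq_zero_of_le_norm (x := y) (by linarith), zero_sub, abs_neg,
        abs_of_nonneg cutoffTrunc_nonneg]
      have h1 := cutoffTrunc_le (r := r) (u := u) (x := x)
      have h2 := norm_sub_norm_le y x
      have h3 : 0 ≤ (K : ℝ) * ‖y - x‖ := by positivity
      linarith
  refine ⟨K + 1, LipschitzWith.of_dist_le_mul fun y x ↦ ?_⟩
  rw [Real.dist_eq, dist_eq_norm, NNReal.coe_add, NNReal.coe_one]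
  by_cases hx : ‖x‖ < r - 1
  · exact key x y hx
  by_cases hy : ‖y‖ < r - 1
  · rw [abs_sub_comm, norm_sub_rev]
    exact key y x hy
  · rw [cutoffTrunc_eq_zero_of_le_norm (x := y) (by linarith),
      cutoffTrunc_eq_zero_of_le_norm (x := x) (by linarith), sub_self, abs_zero]
    positivity

theorem hasCompactSupport_cutoffTrunc : HasCompactSupport (cutoffTrunc r u) :=
  HasCompactSupport.intro (isCompact_closedBall 0 r) fun x hx ↦
    cutoffTrunc_eq_zero_of_le_norm (by
      rw [mem_closedBall_zero_iff] at hx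
      linarith)

theorem lineDeriv_cutoffTrunc_eq_zero (h : cutoffTrunc r u =ᶠ[nhds x] fun _ ↦ 0)
    (v : EuclideanSpace ℝ (Fin n)) : lineDeriv ℝ (cutoffTrunc r u) x v = 0 := by
  rw [h.lineDeriv_eq]
  simp [lineDeriv]

theorem norm_add_one_le_lowerDensity {p m : ℝ} (hp : 1 < p) (hm : 0 < m) (h1 : -1 / 2 ≤ u x)
    (h2 : u x ≤ 0) : ‖gradient u x‖ ≤ 2 ^ m * lowerDensity p m u x := by
  have h3 : ‖gradient u x‖ ≤ ‖gradient u x‖ ^ p + 1 := by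
    rcases le_total ‖gradient u x‖ 1 with h | h
    · linarith [Real.rpow_nonneg (norm_nonneg (gradient u x)) p]
    · linarith [Real.self_le_rpow_of_one_le h hp.le]
  have h4 : (1 : ℝ) ≤ 2 ^ m * |u x + 1| ^ m := by
    rw [← Real.mul_rpow two_pos.le (abs_nonneg _)]
    refine Real.one_le_rpow ?_ hm.le
    rw [abs_of_nonneg (by linarith)]
    linarith
  have h5 : (1 : ℝ) ≤ 2 ^ m := Real.one_le_rpow one_le_two hm.le
  have h6 := Real.rpow_nonneg (norm_nonneg (gradient u x)) p
  rw [lowerDensity, if_pos h2, mul_one, mul_add]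
  nlinarith

theorem enorm_lineDeriv_cutoffTrunc_le {p m : ℝ} (hp : 1 < p) (hm : 0 < m)
    (hux : x ∈ ball 0 r → DifferentiableAt ℝ u x)
    {v : EuclideanSpace ℝ (Fin n)} (hv : ‖v‖ = 1) :
    ‖lineDeriv ℝ (cutoffTrunc r u) x v‖ₑ ≤
      (ball 0 (r - 1) ∩ {y | -1 / 2 ≤ u y}).indicator
          (fun y ↦ ENNReal.ofReal (2 ^ m * lowerDensity p m u y)) x +
        ((ball 0 (r - 1) \ ball 0 (r - 2)) ∩ {y | -1 / 2 ≤ u y}).indicator 1 x := by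
  by_cases hxr : r - 3 / 2 < ‖x‖
  · rw [lineDeriv_cutoffTrunc_eq_zero]
    · simp
    · filter_upwards [(isOpen_lt continuous_const continuous_norm).mem_nhds hxr] with y hy
      exact cutoffTrunc_eq_zero_of_le_norm (le_of_lt hy)
  have hxball : x ∈ ball 0 r := by
    rw [mem_ball_zero_iff]; linarith
  have hx1 : x ∈ ball 0 (r - 1) := by
    rw [mem_ball_zero_iff]; linarith
  have hcx : ContinuousAt u x := (hux hxball).continuousAt
  by_cases hu1 : u x < -1 / 2
  · rw [lineDeriv_cutoffTrunc_eq_zero]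
    · simp
    · filter_upwards [hcx.eventually (gt_mem_nhds hu1)] with y hy
      exact cutoffTrunc_eq_zero_of_le hy.le
  rw [not_lt] at hu1
  set G := ENNReal.ofReal (2 ^ m * lowerDensity p m u x)
  have hA : (ball 0 (r - 1) ∩ {y | -1 / 2 ≤ u y}).indicator
      (fun y ↦ ENNReal.ofReal (2 ^ m * lowerDensity p m u y)) x = G :=
    indicator_of_mem (mem_inter hx1 hu1) _
  rw [hA]
  obtain ⟨c, hc0, hc, hcS⟩ : ∃ c : ℝ, 0 ≤ c ∧ (∀ᶠ y in nhds x,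
      |max 0 (‖y‖ - (r - 2)) - max 0 (‖x‖ - (r - 2))| ≤ c * ‖y - x‖) ∧ ENNReal.ofReal c ≤
      ((ball 0 (r - 1) \ ball 0 (r - 2)) ∩ {y | -1 / 2 ≤ u y}).indicator 1 x := by
    by_cases hx2 : x ∈ ball 0 (r - 2)
    · refine ⟨0, le_rfl, ?_, by simp⟩
      filter_upwards [isOpen_ball.mem_nhds hx2] with y hy
      rw [mem_ball_zero_iff] at hx2 hy
      rw [max_eq_left (by linarith), max_eq_left (by linarith)]
      simp
    · refine ⟨1, zero_le_one, Filter.Eventually.of_forall fun y ↦ ?_, ?_⟩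
      · rw [one_mul]; exact abs_radial_sub_le
      · rw [indicator_of_mem (mem_inter (mem_sdiff_of_mem hx1 hx2) hu1)]; simp
  obtain ⟨d, hd0, hd, hdG⟩ : ∃ d : ℝ, 0 ≤ d ∧ (∀ ε > 0, ∀ᶠ y in nhds x,
      |min (u y) 0 - min (u x) 0| ≤ (d + ε) * ‖y - x‖) ∧ ENNReal.ofReal d ≤ G := by
    by_cases hu0 : 0 < u x
    · refine ⟨0, le_rfl, fun ε hε ↦ ?_, by simp⟩
      filter_upwards [hcx.eventually (lt_mem_nhds hu0)] with y hy
      rw [min_eq_right hy.le, min_eq_right hu0.le, sub_self, abs_zero]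
      positivity
    · rw [not_lt] at hu0
      refine ⟨‖gradient u x‖, norm_nonneg _, fun ε hε ↦ ?_,
        ENNReal.ofReal_le_ofReal (norm_add_one_le_lowerDensity hp hm hu1 hu0)⟩
      filter_upwards [(hux hxball).hasFDerivAt.isLittleO.def hε] with y hy
      refine (abs_min_zero_sub_le _ _).trans ?_
      have h1 := (fderiv ℝ u x).le_opNorm (y - x)
      rw [Real.norm_eq_abs] at hy h1
      rw [norm_gradient]
      have h2 := abs_sub_abs_le_abs_sub (u y - u x) (fderiv ℝ u x (y - x))
      linarith
  have hle : ‖lineDeriv ℝ (cutoffTrunc r u) x v‖ ≤ d + c := by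
    refine le_of_forall_pos_le_add fun ε hε ↦ ?_
    have h := norm_lineDeriv_le_of_lip' (𝕜 := ℝ) (f := cutoffTrunc r u) (x₀ := x) (v := v)
      (C := d + c + ε) (by positivity) (by
        filter_upwards [hc, hd ε hε] with y hy1 hy2
        rw [Real.norm_eq_abs]
        linarith [abs_cutoffTrunc_sub_le (r := r) (u := u) (x := x) (y := y)])
    simpa [hv] using h
  rw [← ofReal_norm]
  refine (ENNReal.ofReal_le_ofReal hle).trans ?_
  rw [ENNReal.ofReal_add hd0 hc0]
  gcongr

/-- Isoperimetric-type estimate for the set where `u` is nonnegative. -/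
theorem volume_nonneg_le_lintegral_lowerDensity {p m q : ℝ} (hp : 1 < p) (hm : 0 < m)
    (hq : Real.HolderConjugate n q) {K : NNReal} (hK : LipschitzOnWith K u (closedBall 0 r))
    {D : Set (EuclideanSpace ℝ (Fin n))} (hD : ball 0 (r - 1) ∩ {y | -1 / 2 ≤ u y} ⊆ D) :
    ENNReal.ofReal (1 / 2) ^ q * volume ({x | 0 ≤ u x} ∩ ball 0 (r - 2)) ≤
      (n * (ENNReal.ofReal (2 ^ m) * (∫⁻ x in D, ENNReal.ofReal (lowerDensity p m u x)) +
        volume ((ball 0 (r - 1) \ ball 0 (r - 2)) ∩ {x | -1 / 2 ≤ u x}))) ^ q := by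
  have huc := hK.continuousOn
  have hmeas : ∀ a : ℝ, ∀ B ⊆ closedBall (0 : EuclideanSpace ℝ (Fin n)) r, MeasurableSet B →
      MeasurableSet (B ∩ {x | a ≤ u x}) := by
    intro a B hB hBm
    have h1 := (huc.preimage_isClosed_of_isClosed isClosed_closedBall
      (isClosed_Ici (a := a))).measurableSet
    convert! hBm.inter h1 using 1
    ext x
    constructor
    · exact fun h ↦ ⟨h.1, hB h.1, h.2⟩
    · exact fun h ↦ ⟨h.1, h.2.2⟩
  have hball : ∀ t ≤ r, ball (0 : EuclideanSpace ℝ (Fin n)) t ⊆ closedBall 0 r := fun t ht ↦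
    (ball_subset_ball ht).trans ball_subset_closedBall
  obtain ⟨C, hC⟩ := exists_lipschitzWith_cutoffTrunc hK
  have hae : ∀ᵐ x, x ∈ ball (0 : EuclideanSpace ℝ (Fin n)) r → DifferentiableAt ℝ u x := by
    filter_upwards [hK.ae_differentiableWithinAt_of_mem (μ := volume)] with x hx hxr
    exact (hx (ball_subset_closedBall hxr)).differentiableAt
      (Filter.mem_of_superset (isOpen_ball.mem_nhds hxr) ball_subset_closedBall)
  have hgns := lintegral_pow_le_pow_lintegral_of_enorm_lineDeriv_le hq hC
    hasCompactSupport_cutoffTrunc (hae.mono fun x hx v hv ↦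
      enorm_lineDeriv_cutoffTrunc_le hp hm hx hv)
  have hP := hmeas 0 _ (hball (r - 2) (by linarith)) measurableSet_ball
  have hB := hmeas (-1 / 2) _ (sdiff_subset.trans (hball (r - 1) (by linarith)))
    (measurableSet_ball.diff (measurableSet_ball (x := 0) (ε := r - 2)))
  have hA := hmeas (-1 / 2) _ (hball (r - 1) (by linarith)) measurableSet_ball
  have hq0 : 0 ≤ q := hq.symm.nonneg
  calc ENNReal.ofReal (1 / 2) ^ q * volume ({x | 0 ≤ u x} ∩ ball 0 (r - 2))
      = ∫⁻ _ in ball 0 (r - 2) ∩ {x | 0 ≤ u x}, ENNReal.ofReal (1 / 2) ^ q := by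
        rw [setLIntegral_const, inter_comm]
    _ ≤ ∫⁻ x in ball 0 (r - 2) ∩ {x | 0 ≤ u x}, ‖cutoffTrunc r u x‖ₑ ^ q := by
        refine setLIntegral_mono' hP fun x hx ↦ ?_
        rw [cutoffTrunc_eq_half (by simpa using hx.1) hx.2, Real.enorm_eq_ofReal (by norm_num)]
    _ ≤ ∫⁻ x, ‖cutoffTrunc r u x‖ₑ ^ q := setLIntegral_le_lintegral _ _
    _ ≤ _ := hgns
    _ ≤ _ := by
        gcongr
        rw [lintegral_add_right _ (measurable_one.indicator hB), lintegral_indicator hA,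
          lintegral_indicator_one hB]
        gcongr
        rw [← lintegral_const_mul' _ _ ENNReal.ofReal_ne_top]
        refine (lintegral_mono_set hD).trans (lintegral_mono fun x ↦ ?_)
        rw [ENNReal.ofReal_mul (by positivity)]

end cutoffTrunc

/-- A `Q`-minimizer, with values in `[-1, 1]`, of some energy with two-sided growth. -/
def IsGrowthQMin {n : ℕ} (p m Q lam Lam : ℝ) (Ω : Set (EuclideanSpace ℝ (Fin n)))
    (u : EuclideanSpace ℝ (Fin n) → ℝ) : Prop :=
  (∀ x, u x ∈ Icc (-1 : ℝ) 1) ∧ LocLipOn Ω u ∧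
    ∃ Efun : EuclideanSpace ℝ (Fin n) → ℝ → EuclideanSpace ℝ (Fin n) → ℝ,
      Measurable (fun q : EuclideanSpace ℝ (Fin n) × ℝ × EuclideanSpace ℝ (Fin n) =>
        Efun q.1 q.2.1 q.2.2) ∧
      EnergyGrowth p m lam Lam Ω Efun ∧ IsQMin Q Ω Efun u

section volume

variable {n : ℕ}

theorem volume_inter_ball_ne_top (G : Set (EuclideanSpace ℝ (Fin n))) (t : ℝ) :
    volume (G ∩ ball 0 t) ≠ ⊤ :=
  ne_top_of_le_ne_top measure_ball_lt_top.ne (measure_mono inter_subset_right)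

theorem measureReal_inter_ball_sdiff (G : Set (EuclideanSpace ℝ (Fin n))) {t r : ℝ} (h : t ≤ r) :
    volume.real (G ∩ (ball 0 r \ ball 0 t)) =
      volume.real (G ∩ ball 0 r) - volume.real (G ∩ ball 0 t) := by
  have h1 := measureReal_inter_add_sdiff (μ := volume) (s := G ∩ ball 0 r)
    (measurableSet_ball (x := (0 : EuclideanSpace ℝ (Fin n))) (ε := t))
    (volume_inter_ball_ne_top G r)
  rw [inter_assoc, inter_eq_self_of_subset_right (ball_subset_ball h), inter_sdiff_assoc] at h1
  linarith

theorem measureReal_inter_ball_mono (G : Set (EuclideanSpace ℝ (Fin n))) {t r : ℝ} (h : t ≤ r) :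
    volume.real (G ∩ ball 0 t) ≤ volume.real (G ∩ ball 0 r) :=
  measureReal_mono (inter_subset_inter_right _ (ball_subset_ball h)) (volume_inter_ball_ne_top G r)

end volume

/-- The constant in front of the boundary layer energy. -/
def layerConst (p m Q lam Lam : ℝ) : ℝ := Q * Lam / lam * (2 ^ p + 2 ^ m)

theorem layerConst_nonneg {p m Q lam Lam : ℝ} (hQ : 1 ≤ Q) (hlam : 0 < lam) (hlL : lam ≤ Lam) :
    0 ≤ layerConst p m Q lam Lam := by
  have : 0 < Lam := by linarith
  rw [layerConst]
  positivity

/-- The constant in the isoperimetric-type estimate. -/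
def isoConst (n : ℕ) (p m Q lam Lam : ℝ) : ℝ := 2 * n * (2 ^ m * layerConst p m Q lam Lam + 1)

section

variable {n : ℕ} {p m Q lam Lam : ℝ} {Ω : Set (EuclideanSpace ℝ (Fin n))}
    {u : EuclideanSpace ℝ (Fin n) → ℝ} {r s L : ℝ}

theorem IsGrowthQMin.lintegral_le (hp : 1 < p) (hpm : p < m) (hQ : 1 ≤ Q) (hlam : 0 < lam)
    (hlL : lam ≤ Lam) (h : IsGrowthQMin p m Q lam Lam Ω u) (hr : closedBall 0 r ⊆ Ω) (hs : 0 < s)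
    (hs1 : s ≤ 1) (hL : 2 ≤ L) :
    ∫⁻ x in exceedSet s L r u, ENNReal.ofReal (lowerDensity p m u x) ≤
      ENNReal.ofReal (layerConst p m Q lam Lam *
        (volume.real ({x | s / 2 - 1 ≤ u x} ∩ (ball 0 r \ ball 0 (r - 1))) +
          ((s / L) ^ p + s ^ m) *
            volume.real (ball (0 : EuclideanSpace ℝ (Fin n)) r \ ball 0 (r - L)))) := by
  obtain ⟨hu, huL, Efun, hEm, hE, huQ⟩ := h
  have hp0 : 0 < p := by linarith
  have hm0 : 0 < m := by linarith
  have hLam : 0 < Lam := by linarith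
  have hK : 0 ≤ Q * Lam / lam := by positivity
  have hC : (1 : ℝ) ≤ 2 ^ p + 2 ^ m := by
    linarith [Real.one_le_rpow one_le_two hp0.le, Real.rpow_nonneg two_pos.le m]
  have hκ : 0 ≤ (s / L) ^ p + s ^ m := by positivity
  refine (lintegral_lowerDensity_exceedSet_le hp hpm hQ hlam hlL hEm hE hu huL huQ hr hs hs1
    (by linarith)).trans ?_
  rw [layerConst, mul_assoc, ENNReal.ofReal_mul hK]
  gcongr
  generalize (2 : ℝ) ^ p + 2 ^ m = c at hC ⊢
  generalize (s / L) ^ p + s ^ m = κ at hκ ⊢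
  set A := {x | s / 2 - 1 ≤ u x} ∩ (ball 0 r \ ball 0 (r - 1))
  have hA : volume A ≠ ⊤ :=
    ne_top_of_le_ne_top measure_ball_lt_top.ne (measure_mono (inter_subset_right.trans sdiff_subset))
  have hS : volume (ball (0 : EuclideanSpace ℝ (Fin n)) r \ ball 0 (r - L)) ≠ ⊤ :=
    ne_top_of_le_ne_top measure_ball_lt_top.ne (measure_mono sdiff_subset)
  have hDA : exceedSet s L r u ∩ (ball 0 r \ ball 0 (r - 1)) ⊆ A := by
    rintro x ⟨hx, hx2⟩
    refine ⟨?_, hx2⟩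
    have h1 := hx2.2
    rw [mem_ball_zero_iff, not_lt] at h1
    have h2 := half_le_barrier hs.le hL (t := r - ‖x‖) (by linarith)
    have h3 : radialBarrier s L r x < u x := hx.2
    rw [radialBarrier] at h3
    show s / 2 - 1 ≤ u x
    linarith
  calc _ ≤ ENNReal.ofReal c * volume A + ENNReal.ofReal κ *
        volume (ball (0 : EuclideanSpace ℝ (Fin n)) r \ ball 0 (r - L)) := by gcongr
    _ = ENNReal.ofReal (c * volume.real A + κ *
        volume.real (ball (0 : EuclideanSpace ℝ (Fin n)) r \ ball 0 (r - L))) := by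
        rw [ENNReal.ofReal_add (by positivity) (by positivity), ENNReal.ofReal_mul (by positivity),
          ENNReal.ofReal_mul (by positivity), ofReal_measureReal hA, ofReal_measureReal hS]
    _ ≤ _ := by
        refine ENNReal.ofReal_le_ofReal ?_
        rw [mul_add]
        exact add_le_add le_rfl (le_mul_of_one_le_left (by positivity) hC)

theorem IsGrowthQMin.volume_transition_le (hp : 1 < p) (hpm : p < m) (hQ : 1 ≤ Q) (hlam : 0 < lam)
    (hlL : lam ≤ Lam) (h : IsGrowthQMin p m Q lam Lam Ω u) (hr : closedBall 0 r ⊆ Ω) (hs : 0 < s)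
    (hs1 : s ≤ 1) (hL : 2 ≤ L) :
    (s / 2) ^ m * volume.real ({x | s / 2 - 1 ≤ u x ∧ u x < 0} ∩ ball 0 (r - L)) ≤
      layerConst p m Q lam Lam * (1 + ((s / L) ^ p + s ^ m)) *
        volume.real (ball (0 : EuclideanSpace ℝ (Fin n)) r \ ball 0 (r - L)) := by
  have hm0 : 0 < m := by linarith
  have hLc : 0 ≤ layerConst p m Q lam Lam := layerConst_nonneg hQ hlam hlL
  have hκ : 0 ≤ (s / L) ^ p + s ^ m := by positivity
  have h1 := h.lintegral_le hp hpm hQ hlam hlL hr hs hs1 hL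
  set Z := {x | s / 2 - 1 ≤ u x ∧ u x < 0} ∩ ball 0 (r - L) with hZdef
  have hball : ball (0 : EuclideanSpace ℝ (Fin n)) (r - L) ⊆ ball 0 r :=
    ball_subset_ball (by linarith)
  have hZm : MeasurableSet Z := by
    obtain ⟨K, hK⟩ := h.2.1.exists_lipschitzOnWith (isCompact_closedBall 0 r) hr
    have h2 := hK.continuousOn.preimage_isClosed_of_isClosed isClosed_closedBall
      (isClosed_Ici (a := s / 2 - 1))
    have h3 := (hK.continuousOn.mono ball_subset_closedBall).isOpen_inter_preimage isOpen_ball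
      (isOpen_Iio (a := (0 : ℝ)))
    have h4 : Z = (closedBall 0 r ∩ u ⁻¹' Ici (s / 2 - 1)) ∩ (ball 0 r ∩ u ⁻¹' Iio 0) ∩
        ball 0 (r - L) := by
      ext x
      constructor
      · rintro ⟨hx, hxb⟩
        exact ⟨⟨⟨ball_subset_closedBall (hball hxb), hx.1⟩, hball hxb, hx.2⟩, hxb⟩
      · rintro ⟨⟨⟨-, hx⟩, -, hx'⟩, hxb⟩
        exact ⟨⟨hx, hx'⟩, hxb⟩
    rw [h4]
    exact (h2.measurableSet.inter h3.measurableSet).inter measurableSet_ball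
  have hZD : Z ⊆ exceedSet s L r u := by
    rintro x ⟨⟨hx, -⟩, hxb⟩
    refine ⟨hball hxb, ?_⟩
    rw [mem_ball_zero_iff] at hxb
    show radialBarrier s L r x < u x
    rw [radialBarrier, barrier_eq_zero hs.le (by linarith) (by linarith)]
    linarith
  have h5 : ENNReal.ofReal ((s / 2) ^ m * volume.real Z) ≤
      ∫⁻ x in exceedSet s L r u, ENNReal.ofReal (lowerDensity p m u x) := by
    rw [ENNReal.ofReal_mul (by positivity),
      ofReal_measureReal (ne_top_of_le_ne_top measure_ball_lt_top.ne (measure_mono inter_subset_right)),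
      ← setLIntegral_const]
    refine (setLIntegral_mono' hZm fun x hx ↦ ENNReal.ofReal_le_ofReal ?_).trans
      (lintegral_mono_set hZD)
    obtain ⟨⟨hx, hx'⟩, -⟩ := hx
    rw [lowerDensity, if_pos hx'.le, mul_one]
    have h6 : s / 2 ≤ |u x + 1| := (by linarith : s / 2 ≤ u x + 1).trans (le_abs_self _)
    have h7 : (s / 2) ^ m ≤ |u x + 1| ^ m := by gcongr
    linarith [Real.rpow_nonneg (norm_nonneg (gradient u x)) p]
  have h8 := (ENNReal.ofReal_le_ofReal_iff (by positivity)).1 (h5.trans h1)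
  refine h8.trans ?_
  generalize (s / L) ^ p + s ^ m = κ at hκ ⊢
  rw [mul_assoc, add_mul, one_mul]
  gcongr
  · exact ne_top_of_le_ne_top measure_ball_lt_top.ne (measure_mono sdiff_subset)
  · exact inter_subset_right.trans (sdiff_subset_sdiff_right (ball_subset_ball (by linarith)))

theorem IsGrowthQMin.volume_nonneg_rpow_le (hp : 1 < p) (hpm : p < m) (hQ : 1 ≤ Q) (hlam : 0 < lam)
    (hlL : lam ≤ Lam) (h : IsGrowthQMin p m Q lam Lam Ω u) (hr : closedBall 0 r ⊆ Ω) (hs : 0 < s)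
    (hs1 : s ≤ 1 / 2) (hL : 2 ≤ L) {q : ℝ} (hq : Real.HolderConjugate n q) :
    volume.real ({x | 0 ≤ u x} ∩ ball 0 (r - 2)) ^ q⁻¹ ≤
      isoConst n p m Q lam Lam *
        (volume.real ({x | s / 2 - 1 ≤ u x} ∩ (ball 0 r \ ball 0 (r - 2))) +
          ((s / L) ^ p + s ^ m) *
            volume.real (ball (0 : EuclideanSpace ℝ (Fin n)) r \ ball 0 (r - L))) := by
  have hm0 : 0 < m := by linarith
  have hLc : 0 ≤ layerConst p m Q lam Lam := layerConst_nonneg hQ hlam hlL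
  have hκ : 0 ≤ (s / L) ^ p + s ^ m := by positivity
  have hq0 : 0 < q := hq.symm.pos
  have h1 := h.lintegral_le hp hpm hQ hlam hlL hr hs (by linarith) hL
  obtain ⟨K, hK⟩ := h.2.1.exists_lipschitzOnWith (isCompact_closedBall 0 r) hr
  have h2 := volume_nonneg_le_lintegral_lowerDensity hp hm0 hq hK (D := exceedSet s L r u) (by
    rintro x ⟨hx, hx'⟩
    refine ⟨ball_subset_ball (by linarith) hx, ?_⟩
    rw [mem_ball_zero_iff] at hx
    have h3 := barrier_lt hs (by linarith : 0 < L) (t := r - ‖x‖) (by linarith)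
    show radialBarrier s L r x < u x
    have h4 : -1 / 2 ≤ u x := hx'
    rw [radialBarrier]
    linarith)
  set W := volume.real ({x | s / 2 - 1 ≤ u x} ∩ (ball 0 r \ ball 0 (r - 2)))
  set T := volume.real (ball (0 : EuclideanSpace ℝ (Fin n)) r \ ball 0 (r - L))
  have hGfin : volume ({x | s / 2 - 1 ≤ u x} ∩ (ball 0 r \ ball 0 (r - 2))) ≠ ⊤ :=
    ne_top_of_le_ne_top measure_ball_lt_top.ne (measure_mono (inter_subset_right.trans sdiff_subset))
  have hW : volume ((ball 0 (r - 1) \ ball 0 (r - 2)) ∩ {x | -1 / 2 ≤ u x}) ≤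
      ENNReal.ofReal W := by
    rw [ofReal_measureReal hGfin]
    refine measure_mono fun x hx ↦ ⟨?_, ball_subset_ball (by linarith) hx.1.1, hx.1.2⟩
    have h4 : -1 / 2 ≤ u x := hx.2
    show s / 2 - 1 ≤ u x
    linarith
  have hW' : volume.real ({x | s / 2 - 1 ≤ u x} ∩ (ball 0 r \ ball 0 (r - 1))) ≤ W :=
    measureReal_mono (inter_subset_inter_right _
      (sdiff_subset_sdiff_right (ball_subset_ball (by linarith)))) hGfin
  have h5 : ENNReal.ofReal (1 / 2) ^ q * volume ({x | 0 ≤ u x} ∩ ball 0 (r - 2)) ≤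
      ENNReal.ofReal (n * (2 ^ m * (layerConst p m Q lam Lam *
        (W + ((s / L) ^ p + s ^ m) * T)) + W)) ^ q := by
    refine h2.trans ?_
    gcongr
    rw [ENNReal.ofReal_mul (by positivity), ENNReal.ofReal_natCast,
      ENNReal.ofReal_add (by positivity) (by positivity), ENNReal.ofReal_mul (by positivity)]
    gcongr
    refine h1.trans (ENNReal.ofReal_le_ofReal ?_)
    gcongr
  rw [ENNReal.ofReal_rpow_of_nonneg (by positivity) hq0.le,
    ENNReal.ofReal_rpow_of_nonneg (by positivity) hq0.le,
    ← ofReal_measureReal (volume_inter_ball_ne_top _ _), ← ENNReal.ofReal_mul (by positivity),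
    ENNReal.ofReal_le_ofReal_iff (by positivity)] at h5
  rw [Real.rpow_inv_le_iff_of_pos (by positivity) (by rw [isoConst]; positivity) hq0]
  have h6 : volume.real ({x | 0 ≤ u x} ∩ ball 0 (r - 2)) ≤ (2 * (n * (2 ^ m *
      (layerConst p m Q lam Lam * (W + ((s / L) ^ p + s ^ m) * T)) + W))) ^ q := by
    rw [Real.mul_rpow two_pos.le (by positivity)]
    have h7 : (2 : ℝ) ^ q * (1 / 2) ^ q = 1 := by
      rw [← Real.mul_rpow] <;> norm_num
    calc _ = 2 ^ q * ((1 / 2) ^ q * volume.real ({x | 0 ≤ u x} ∩ ball 0 (r - 2))) := by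
          rw [← mul_assoc, h7, one_mul]
      _ ≤ _ := by gcongr
  refine h6.trans ?_
  generalize (s / L) ^ p + s ^ m = κ at hκ ⊢
  refine Real.rpow_le_rpow (by positivity) ?_ hq0.le
  rw [isoConst, ← sub_nonneg]
  have : 0 ≤ 2 * n * (κ * T) := by positivity
  linarith

end

section scale

theorem measureReal_ball_zero_eq {n : ℕ} (hn : n ≠ 0) {t : ℝ} (ht : 0 ≤ t) :
    volume.real (ball (0 : EuclideanSpace ℝ (Fin n)) t) =
      t ^ n * volume.real (ball (0 : EuclideanSpace ℝ (Fin n)) 1) := by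
  have : NeZero n := ⟨hn⟩
  rw [measureReal_def, Measure.addHaar_ball volume (0 : EuclideanSpace ℝ (Fin n)) ht,
    ENNReal.toReal_mul, ENNReal.toReal_ofReal (by positivity), finrank_euclideanSpace_fin,
    measureReal_def]

theorem measureReal_shell_le {n : ℕ} (hn : n ≠ 0) {r R L : ℝ} (hL : 0 ≤ L) (hLr : L ≤ r) (hrR : r ≤ R) :
    volume.real (ball (0 : EuclideanSpace ℝ (Fin n)) r \ ball 0 (r - L)) ≤
      n * L * R ^ (n - 1) * volume.real (ball (0 : EuclideanSpace ℝ (Fin n)) 1) := by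
  have h := measureReal_inter_ball_sdiff (n := n) univ (sub_le_self r hL)
  simp only [univ_inter] at h
  rw [h, measureReal_ball_zero_eq hn (hL.trans hLr), measureReal_ball_zero_eq hn (sub_nonneg.2 hLr), ← sub_mul]
  gcongr
  have hr : 0 ≤ r := hL.trans hLr
  rcases hr.eq_or_lt with rfl | hr
  · obtain rfl : L = 0 := le_antisymm hLr hL
    simp
  have hb := one_add_mul_le_pow (a := -(L / r)) (by
    have : L / r ≤ 1 := (div_le_one hr).2 hLr
    linarith) n
  have h2 : (r - L) ^ n = r ^ n * (1 + -(L / r)) ^ n := by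
    rw [← mul_pow]; congr 1; field_simp; ring
  rcases n with _ | k
  · simp
  have h3 : r ^ (k + 1) * (1 + (k + 1 : ℕ) * -(L / r)) ≤ (r - L) ^ (k + 1) := by
    rw [h2]; gcongr
  have h4 : r ^ (k + 1) * (1 + (k + 1 : ℕ) * -(L / r)) =
      r ^ (k + 1) - (k + 1 : ℕ) * L * r ^ k := by
    field_simp; ring
  have h5 : ((k + 1 : ℕ) : ℝ) * L * r ^ k ≤ (k + 1 : ℕ) * L * R ^ k := by gcongr
  simp only [add_tsub_cancel_right]
  linarith

/-- The barrier parameters can be chosen with arbitrarily small bulk energy. -/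
theorem exists_barrier_parameters {p m : ℝ} (hp : 1 < p) (hpm : p < m) {c : ℝ} (hc : 0 < c) :
    ∃ s L : ℝ, 0 < s ∧ s ≤ 1 / 2 ∧ 2 ≤ L ∧ L * ((s / L) ^ p + s ^ m) ≤ c := by
  have h1 : Filter.Tendsto (fun s : ℝ ↦ s ^ p + s ^ (m - p)) (nhdsWithin 0 (Ioi 0)) (nhds 0) := by
    have h2 := (Real.continuousAt_rpow_const 0 p (Or.inr (by linarith))).tendsto
    have h3 := (Real.continuousAt_rpow_const 0 (m - p) (Or.inr (by linarith))).tendsto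
    have h4 := h2.add h3
    rw [Real.zero_rpow (by linarith), Real.zero_rpow (by linarith), add_zero] at h4
    exact h4.mono_left nhdsWithin_le_nhds
  obtain ⟨s, hsc, hs0, hs1⟩ := ((h1.eventually (gt_mem_nhds hc)).and
    (Ioc_mem_nhdsGT (show (0 : ℝ) < 1 / 2 by norm_num))).exists
  have hsp : s ^ p ≤ 1 / 2 := by
    refine le_trans ?_ hs1
    simpa using Real.rpow_le_rpow_of_exponent_ge hs0 (by linarith) hp.le
  have hspos : 0 < s ^ p := Real.rpow_pos_of_pos hs0 p
  have hL : 2 ≤ (s ^ p)⁻¹ := by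
    rw [le_inv_comm₀ two_pos hspos]; linarith
  refine ⟨s, (s ^ p)⁻¹, hs0, hs1, hL, ?_⟩
  refine le_trans ?_ hsc.le
  rw [mul_add]
  have h5 : (s ^ p)⁻¹ * s ^ m = s ^ (m - p) := by
    rw [Real.rpow_sub hs0]; field_simp
  rw [h5]
  gcongr
  have h6 : (s / (s ^ p)⁻¹) ^ p = s ^ p * (s ^ p) ^ p := by
    rw [div_inv_eq_mul, Real.mul_rpow hs0.le hspos.le]
  have h7 : (s ^ p) ^ p ≤ s ^ p := by
    simpa using Real.rpow_le_rpow_of_exponent_ge hspos (by linarith) hp.le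
  rw [h6]
  calc (s ^ p)⁻¹ * (s ^ p * (s ^ p) ^ p) = (s ^ p) ^ p := by field_simp
    _ ≤ _ := h7

variable {n : ℕ} {p m Q lam Lam : ℝ} {Ω : Set (EuclideanSpace ℝ (Fin n))}
    {u : EuclideanSpace ℝ (Fin n) → ℝ} {R s L : ℝ}

theorem IsGrowthQMin.volume_nonneg_half_rpow_le (hn : n ≠ 0) (hp : 1 < p) (hpm : p < m) (hQ : 1 ≤ Q)
    (hlam : 0 < lam) (hlL : lam ≤ Lam) (h : IsGrowthQMin p m Q lam Lam Ω u) (hR : ball 0 R ⊆ Ω)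
    (hs : 0 < s) (hs1 : s ≤ 1 / 2) (hL : 2 ≤ L) (hRL : 4 * (3 + L) ≤ R) {q : ℝ}
    (hq : Real.HolderConjugate n q) :
    R / 8 * volume.real ({x | 0 ≤ u x} ∩ ball 0 (R / 2)) ^ q⁻¹ ≤
      isoConst n p m Q lam Lam *
        (volume.real ({x | 0 ≤ u x} ∩ ball 0 R) +
          volume.real ({x | s / 2 - 1 ≤ u x ∧ u x < 0} ∩ ball 0 (R - 1 - L)) +
          R / 4 * (((s / L) ^ p + s ^ m) *
            (n * L * R ^ (n - 1) * volume.real (ball (0 : EuclideanSpace ℝ (Fin n)) 1)))) := by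
  have hC : 0 ≤ isoConst n p m Q lam Lam := by
    have := layerConst_nonneg (p := p) (m := m) hQ hlam hlL
    rw [isoConst]; positivity
  have hκ : 0 ≤ (s / L) ^ p + s ^ m := by positivity
  set N := ⌈R / 8⌉₊
  have hN : R / 8 ≤ N := Nat.le_ceil _
  have hN1 : (N : ℝ) < R / 8 + 1 := Nat.ceil_lt_add_one (by linarith)
  have hq0 : 0 ≤ q⁻¹ := inv_nonneg.2 hq.symm.nonneg
  set G := {x | s / 2 - 1 ≤ u x}
  set E := ((s / L) ^ p + s ^ m) *
    (n * L * R ^ (n - 1) * volume.real (ball (0 : EuclideanSpace ℝ (Fin n)) 1))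
  have hE : 0 ≤ E := by
    have : 0 ≤ R := by linarith
    positivity
  set V := volume.real ({x | 0 ≤ u x} ∩ ball 0 (R / 2))
  have hring : ∀ j ∈ Finset.range N, V ^ q⁻¹ ≤ isoConst n p m Q lam Lam *
      ((volume.real (G ∩ ball 0 (R / 2 + 2 * ((j + 1 : ℕ) : ℝ))) -
        volume.real (G ∩ ball 0 (R / 2 + 2 * (j : ℝ)))) + E) := by
    intro j hj
    have hjN : (j : ℝ) + 1 ≤ N := by exact_mod_cast Finset.mem_range.1 hj
    have hj0 : (0 : ℝ) ≤ j := j.cast_nonneg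
    have hjr : R / 2 + 2 * ((j + 1 : ℕ) : ℝ) - 2 = R / 2 + 2 * j := by push_cast; ring
    have h1 := h.volume_nonneg_rpow_le hp hpm hQ hlam hlL
      (r := R / 2 + 2 * ((j + 1 : ℕ) : ℝ))
      ((closedBall_subset_ball (by push_cast; linarith)).trans hR) hs hs1 hL hq
    rw [measureReal_inter_ball_sdiff _ (by linarith), hjr] at h1
    refine le_trans (Real.rpow_le_rpow measureReal_nonneg
      (measureReal_inter_ball_mono _ (by linarith)) hq0) (h1.trans ?_)
    gcongr
    exact mul_le_mul_of_nonneg_left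
      (measureReal_shell_le (by omega) (by linarith) (by push_cast; linarith) (by push_cast; linarith)) hκ
  have hsum := Finset.sum_le_sum hring
  rw [Finset.sum_const, Finset.card_range, nsmul_eq_mul, ← Finset.mul_sum,
    Finset.sum_add_distrib,
    Finset.sum_range_sub (fun j : ℕ ↦ volume.real (G ∩ ball 0 (R / 2 + 2 * (j : ℝ)))),
    Finset.sum_const, Finset.card_range, nsmul_eq_mul] at hsum
  have hG : volume.real (G ∩ ball 0 (R / 2 + 2 * (N : ℝ))) ≤
      volume.real ({x | 0 ≤ u x} ∩ ball 0 R) +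
        volume.real ({x | s / 2 - 1 ≤ u x ∧ u x < 0} ∩ ball 0 (R - 1 - L)) := by
    refine le_trans (measureReal_mono ?_ ?_) (measureReal_union_le _ _)
    · rintro x ⟨hx, hxb⟩
      rcases le_or_gt 0 (u x) with h0 | h0
      · exact Or.inl ⟨h0, ball_subset_ball (by linarith) hxb⟩
      · exact Or.inr ⟨⟨hx, h0⟩, ball_subset_ball (by linarith) hxb⟩
    · exact (measure_union_lt_top (volume_inter_ball_ne_top _ _).lt_top
        (volume_inter_ball_ne_top _ _).lt_top).ne
  refine le_trans (mul_le_mul_of_nonneg_right hN (Real.rpow_nonneg measureReal_nonneg _))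
    (hsum.trans (mul_le_mul_of_nonneg_left ?_ hC))
  have h2 : (N : ℝ) * E ≤ R / 4 * E := mul_le_mul_of_nonneg_right (by linarith) hE
  have h3 : 0 ≤ volume.real (G ∩ ball 0 (R / 2 + 2 * ((0 : ℕ) : ℝ))) := measureReal_nonneg
  linarith

/-- Decay of the density of the set where `u` is nonnegative from one scale to half of it. -/
theorem exists_volume_nonneg_half_le (hn : 2 ≤ n) (hp : 1 < p) (hpm : p < m) (hQ : 1 ≤ Q)
    (hlam : 0 < lam) (hlL : lam ≤ Lam) {q : ℝ} (hq : Real.HolderConjugate n q) {η : ℝ}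
    (hη : 0 < η) :
    ∃ R₀ > (0 : ℝ), ∀ R ≥ R₀, ∀ (Ω : Set (EuclideanSpace ℝ (Fin n)))
      (u : EuclideanSpace ℝ (Fin n) → ℝ), IsGrowthQMin p m Q lam Lam Ω u → ball 0 R ⊆ Ω →
      ∀ d : ℝ, volume.real ({x | 0 ≤ u x} ∩ ball 0 R) ≤ d * R ^ n →
        volume.real ({x | 0 ≤ u x} ∩ ball 0 (R / 2)) ≤
          R ^ n * (8 * isoConst n p m Q lam Lam * (d + η)) ^ q := by
  have hCl := layerConst_nonneg (p := p) (m := m) hQ hlam hlL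
  have hC : 0 ≤ isoConst n p m Q lam Lam := by
    rw [isoConst]; positivity
  set ω := volume.real (ball (0 : EuclideanSpace ℝ (Fin n)) 1)
  have hω : 0 ≤ ω := measureReal_nonneg
  obtain ⟨s, L, hs, hs1, hL, hsL⟩ := exists_barrier_parameters hp hpm
    (c := 2 * η / (n * ω + 1)) (by positivity)
  set κ := (s / L) ^ p + s ^ m
  have hκ : 0 ≤ κ := by positivity
  have hκL : κ * (n * L * ω) ≤ 2 * η := by
    rw [le_div_iff₀ (by positivity)] at hsL
    have : 0 ≤ L * κ := by positivity
    linarith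
  set A := ((s / 2) ^ m)⁻¹ * (layerConst p m Q lam Lam * (1 + κ) * (n * L * ω)) with hA
  have hA0 : 0 ≤ A := by positivity
  refine ⟨4 * (3 + L) + 2 * A / η, by positivity, fun R hR Ω u h hRΩ d hd ↦ ?_⟩
  have hAη : 0 ≤ 2 * A / η := by positivity
  have hRL : 4 * (3 + L) ≤ R := by linarith
  have hR0 : 0 < R := by linarith
  have hAR : A ≤ η / 2 * R := by
    have : 2 * A / η ≤ R := by linarith
    rw [div_le_iff₀ hη] at this
    linarith
  have hRn : R * R ^ (n - 1) = R ^ n := by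
    rw [← pow_succ']; congr 1; omega
  have hRn0 : 0 ≤ R ^ (n - 1) := by positivity
  have hz : volume.real ({x | s / 2 - 1 ≤ u x ∧ u x < 0} ∩ ball 0 (R - 1 - L)) ≤
      η / 2 * R ^ n := by
    have h1 := h.volume_transition_le hp hpm hQ hlam hlL (r := R - 1)
      ((closedBall_subset_ball (by linarith)).trans hRΩ) hs (by linarith) hL
    have hsm : 0 < (s / 2) ^ m := by positivity
    rw [← le_inv_mul_iff₀ hsm] at h1
    refine h1.trans ?_
    have h2 := measureReal_shell_le (n := n) (by omega) (r := R - 1) (R := R) (L := L) (by linarith)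
      (by linarith) (by linarith)
    calc _ ≤ ((s / 2) ^ m)⁻¹ * (layerConst p m Q lam Lam * (1 + κ) *
          (n * L * R ^ (n - 1) * ω)) := by gcongr
      _ = A * R ^ (n - 1) := by rw [hA]; ring
      _ ≤ η / 2 * R * R ^ (n - 1) := by gcongr
      _ = _ := by rw [mul_assoc, hRn]
  have hmain := h.volume_nonneg_half_rpow_le (by omega) hp hpm hQ hlam hlL hRΩ hs hs1 hL hRL hq
  set V := volume.real ({x | 0 ≤ u x} ∩ ball 0 (R / 2))
  have hd0 : 0 ≤ d := by
    have h1 : 0 ≤ d * R ^ n := measureReal_nonneg.trans hd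
    exact nonneg_of_mul_nonneg_left h1 (by positivity)
  have hbulk : R / 4 * (κ * (n * L * R ^ (n - 1) * ω)) ≤ η / 2 * R ^ n := by
    calc _ = R * R ^ (n - 1) * (κ * (n * L * ω)) / 4 := by ring
      _ ≤ R * R ^ (n - 1) * (2 * η) / 4 := by gcongr
      _ = _ := by rw [hRn]; ring
  have hV : V ^ q⁻¹ ≤ R ^ (n - 1) * (8 * isoConst n p m Q lam Lam * (d + η)) := by
    have h3 : R / 8 * V ^ q⁻¹ ≤ isoConst n p m Q lam Lam * ((d + η) * R ^ n) :=
      hmain.trans (mul_le_mul_of_nonneg_left (by linarith) hC)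
    rw [← hRn] at h3
    refine le_of_mul_le_mul_left (h3.trans_eq ?_) (show 0 < R / 8 by positivity)
    ring
  have hq0 := hq.symm.pos
  rw [Real.rpow_inv_le_iff_of_pos measureReal_nonneg (by positivity) hq0,
    Real.mul_rpow (by positivity) (by positivity), ← Real.rpow_natCast R (n - 1),
    ← Real.rpow_mul hR0.le] at hV
  have hnq : ((n - 1 : ℕ) : ℝ) * q = n := by
    rw [Nat.cast_sub (by omega), Nat.cast_one]
    exact hq.sub_one_mul_conj
  rwa [hnq, Real.rpow_natCast] at hV

end scale

/-- Iterated decay of the density of the set where `u` is nonnegative along dyadic scales. -/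
theorem volume_nonneg_div_two_pow_le {n : ℕ} {p m Q lam Lam : ℝ} {δ η R₀ R : ℝ} (hη : 0 < η)
    (hηδ : η ≤ δ) {Ω : Set (EuclideanSpace ℝ (Fin n))} {u : EuclideanSpace ℝ (Fin n) → ℝ}
    (hstep : ∀ R ≥ R₀, ∀ (Ω : Set (EuclideanSpace ℝ (Fin n)))
      (u : EuclideanSpace ℝ (Fin n) → ℝ), IsGrowthQMin p m Q lam Lam Ω u → ball 0 R ⊆ Ω →
      ∀ d : ℝ, 0 ≤ d → d ≤ δ → volume.real ({x | 0 ≤ u x} ∩ ball 0 R) ≤ d * R ^ n →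
        volume.real ({x | 0 ≤ u x} ∩ ball 0 (R / 2)) ≤ (d + η) / 4 * (R / 2) ^ n)
    (h : IsGrowthQMin p m Q lam Lam Ω u) (hR0 : 0 ≤ R) (hR : ball 0 R ⊆ Ω)
    (hdens : volume.real ({x | 0 ≤ u x} ∩ ball 0 R) ≤ δ * R ^ n) (k : ℕ)
    (hk : R₀ ≤ R / 2 ^ k) :
    volume.real ({x | 0 ≤ u x} ∩ ball 0 (R / 2 ^ k)) ≤ max (δ / 2 ^ k) η * (R / 2 ^ k) ^ n := by
  have hδ : 0 < δ := hη.trans_le hηδ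
  induction k with
  | zero => simpa [max_eq_left hηδ] using hdens
  | succ k ih =>
    have hR2 : R / 2 ^ (k + 1) = R / 2 ^ k / 2 := by rw [pow_succ]; field_simp
    have hδ2 : δ / 2 ^ (k + 1) = δ / 2 ^ k / 2 := by rw [pow_succ]; field_simp
    have hRk : 0 ≤ R / 2 ^ k := by positivity
    rw [hR2] at hk ⊢
    have hball : ball (0 : EuclideanSpace ℝ (Fin n)) (R / 2 ^ k) ⊆ Ω :=
      (ball_subset_ball (div_le_self hR0 (one_le_pow₀ one_le_two))).trans hR
    have hd : max (δ / 2 ^ k) η ≤ δ :=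
      max_le (div_le_self hδ.le (one_le_pow₀ one_le_two)) hηδ
    refine (hstep _ (by linarith) Ω u h hball _ (le_max_of_le_right hη.le) hd
      (ih (by linarith))).trans ?_
    gcongr
    rw [hδ2]
    rcases le_total (δ / 2 ^ k) η with h1 | h1
    · rw [max_eq_right h1]
      exact le_max_of_le_right (by linarith)
    · rw [max_eq_left h1]
      exact le_max_of_le_left (by linarith)

/-- A superlinear power is eventually smaller than a linear function near zero. -/
theorem exists_mul_rpow_le {a b q : ℝ} (hb : 0 ≤ b) (hq : 1 < q) :
    ∃ δ > (0 : ℝ), ∀ x, 0 ≤ x → x ≤ 2 * δ → a * (b * x) ^ q ≤ x / 4 := by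
  have h1 := ((Real.continuousAt_rpow_const 0 (q - 1) (Or.inr (by linarith))).tendsto.const_mul
    (a * b ^ q)).mono_left (nhdsWithin_le_nhds (s := Ioi 0))
  rw [Real.zero_rpow (by linarith), mul_zero] at h1
  have h2 := h1.eventually (gt_mem_nhds (show (0 : ℝ) < 1 / 4 by norm_num))
  rw [Filter.Eventually, mem_nhdsGT_iff_exists_Ioc_subset] at h2
  obtain ⟨t, ht, hsub⟩ := h2
  refine ⟨t / 2, half_pos ht, fun x hx hxt ↦ ?_⟩
  rcases hx.eq_or_lt with rfl | hx
  · simp [Real.zero_rpow (by linarith : q ≠ 0)]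
  have h3 : a * b ^ q * x ^ (q - 1) < 1 / 4 := hsub ⟨hx, by linarith⟩
  have h4 : x ^ q = x ^ (q - 1) * x := by
    rw [Real.rpow_sub_one hx.ne']; field_simp
  rw [Real.mul_rpow hb hx.le, h4]
  nlinarith

/-- Density estimate for Q-minimizers with a density constant `δ₀` independent of `ε`
(Remark after Theorem 1.2 in the paper). `ρ₀` depends on `ε`, and `R₁` depends
only on the universal constants, `ε` and `ρ`. -/
theorem density_estimate_Qminimizers_uniform_delta
    (n : ℕ) (hn : 2 ≤ n) (p m Q lam Lam : ℝ)
    (hp : 1 < p) (hpm : p < m) (hQ : 1 ≤ Q) (hlam : 0 < lam) (hlL : lam ≤ Lam) :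
    ∃ δ₀ > (0 : ℝ),
      ∀ ε > (0 : ℝ), ∃ ρ₀ > (0 : ℝ),
      ∀ ρ : ℝ, ρ₀ ≤ ρ →
      ∃ R₁ : ℝ,
      ∀ Ω : Set (EuclideanSpace ℝ (Fin n)), IsOpen Ω →
      ∀ Efun : EuclideanSpace ℝ (Fin n) → ℝ → EuclideanSpace ℝ (Fin n) → ℝ,
        Measurable (fun q : EuclideanSpace ℝ (Fin n) × ℝ × EuclideanSpace ℝ (Fin n) =>
          Efun q.1 q.2.1 q.2.2) →
        (∀ ξ τ x, τ ∈ Icc (-1 : ℝ) 1 → x ∈ Ω →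
          0 ≤ Efun ξ τ x ∧
          lam * (‖ξ‖ ^ p + |τ + 1| ^ m * (if τ ≤ 0 then (1 : ℝ) else 0)) ≤ Efun ξ τ x ∧
          Efun ξ τ x ≤ Lam * (‖ξ‖ ^ p + |τ + 1| ^ m)) →
        ∀ u : EuclideanSpace ℝ (Fin n) → ℝ,
          (∀ x, u x ∈ Icc (-1 : ℝ) 1) → LocLipOn Ω u → IsQMin Q Ω Efun u →
          ball (0 : EuclideanSpace ℝ (Fin n)) ρ ⊆ Ω →
          ENNReal.ofReal (ε * ρ ^ n) ≤ volume ({x | 0 ≤ u x} ∩ ball 0 ρ) →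
          ∀ R : ℝ, R₁ ≤ R → ball (0 : EuclideanSpace ℝ (Fin n)) R ⊆ Ω →
            ENNReal.ofReal (δ₀ * R ^ n) ≤ volume ({x | 0 ≤ u x} ∩ ball 0 R) := by
  have hn1 : (1 : ℝ) < n := by exact_mod_cast hn
  obtain ⟨q, hq⟩ : ∃ q, Real.HolderConjugate n q := ⟨_, Real.HolderConjugate.conjExponent hn1⟩
  have hCl := layerConst_nonneg (p := p) (m := m) hQ hlam hlL
  have hC : 0 ≤ isoConst n p m Q lam Lam := by
    rw [isoConst]; positivity
  obtain ⟨δ, hδ, hδq⟩ := exists_mul_rpow_le (a := 2 ^ n) (b := 8 * isoConst n p m Q lam Lam)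
    (by positivity) hq.symm.lt
  refine ⟨δ, hδ, fun ε hε ↦ ?_⟩
  set η := min δ (ε / 2 ^ (n + 1))
  have hη : 0 < η := lt_min hδ (by positivity)
  have hηδ : η ≤ δ := min_le_left _ _
  have hηε : η * 2 ^ n < ε := by
    have h1 : η ≤ ε / 2 ^ (n + 1) := min_le_right _ _
    rw [le_div_iff₀ (by positivity), pow_succ] at h1
    linarith
  obtain ⟨R₀, hR₀, hdecay⟩ := exists_volume_nonneg_half_le (p := p) (m := m) hn hp hpm hQ hlam hlL
    hq hη
  refine ⟨R₀, hR₀, fun ρ hρ ↦ ?_⟩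
  have hρ0 : 0 < ρ := hR₀.trans_le hρ
  obtain ⟨k₀, hk₀⟩ := pow_unbounded_of_one_lt (δ / η) one_lt_two
  refine ⟨2 ^ k₀ * ρ, fun Ω _ Efun hEm hE u hu huL huQ _ hερ R hR hRΩ ↦ ?_⟩
  have hmin : IsGrowthQMin p m Q lam Lam Ω u := ⟨hu, huL, Efun, hEm, hE, huQ⟩
  have hR0 : 0 < R := lt_of_lt_of_le (by positivity) hR
  by_contra! hcon
  rw [← ofReal_measureReal (volume_inter_ball_ne_top _ _),
    ENNReal.ofReal_lt_ofReal_iff (by positivity)] at hcon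
  rw [← ofReal_measureReal (volume_inter_ball_ne_top _ _),
    ENNReal.ofReal_le_ofReal_iff measureReal_nonneg] at hερ
  have hstep : ∀ R ≥ R₀, ∀ (Ω : Set (EuclideanSpace ℝ (Fin n)))
      (u : EuclideanSpace ℝ (Fin n) → ℝ), IsGrowthQMin p m Q lam Lam Ω u → ball 0 R ⊆ Ω →
      ∀ d : ℝ, 0 ≤ d → d ≤ δ → volume.real ({x | 0 ≤ u x} ∩ ball 0 R) ≤ d * R ^ n →
        volume.real ({x | 0 ≤ u x} ∩ ball 0 (R / 2)) ≤ (d + η) / 4 * (R / 2) ^ n := by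
    intro R hR Ω u h hRΩ d hd0 hd hdens
    have h1 := hδq (d + η) (by positivity) (by linarith)
    have hR0 : 0 < R := hR₀.trans_le hR
    calc _ ≤ _ := hdecay R hR Ω u h hRΩ d hdens
      _ = (R / 2) ^ n * (2 ^ n * (8 * isoConst n p m Q lam Lam * (d + η)) ^ q) := by
        rw [div_pow]; field_simp
      _ ≤ (R / 2) ^ n * ((d + η) / 4) := by gcongr
      _ = _ := mul_comm _ _
  have hk₀R : (2 : ℝ) ^ k₀ ≤ R / ρ := by rwa [le_div_iff₀ hρ0]
  obtain ⟨k, hk, hk'⟩ := exists_nat_pow_near ((one_le_pow₀ one_le_two).trans hk₀R) one_lt_two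
  have hk₀k : k₀ ≤ k := by
    have h1 : (2 : ℝ) ^ k₀ < 2 ^ (k + 1) := hk₀R.trans_lt hk'
    have := (pow_lt_pow_iff_right₀ one_lt_two).1 h1
    omega
  have hρk : ρ ≤ R / 2 ^ k := by
    rw [le_div_iff₀ hρ0] at hk
    rw [le_div_iff₀ (by positivity)]
    linarith
  have hRk : R / 2 ^ k ≤ 2 * ρ := by
    rw [div_lt_iff₀ hρ0, pow_succ] at hk'
    rw [div_le_iff₀ (by positivity)]
    linarith
  have hδk : δ / 2 ^ k ≤ η := by
    rw [div_lt_iff₀ hη] at hk₀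
    rw [div_le_iff₀ (by positivity), mul_comm]
    exact hk₀.le.trans (mul_le_mul_of_nonneg_right (pow_le_pow_right₀ one_le_two hk₀k) hη.le)
  have hfinal := volume_nonneg_div_two_pow_le hη hηδ hstep hmin hR0.le hRΩ hcon.le k
    (hρ.trans hρk)
  rw [max_eq_right hδk] at hfinal
  have h2 : η * (R / 2 ^ k) ^ n ≤ η * 2 ^ n * ρ ^ n := by
    rw [mul_assoc, ← mul_pow]
    gcongr
  have h3 : η * 2 ^ n * ρ ^ n < ε * ρ ^ n := by gcongr
  have h4 := measureReal_inter_ball_mono {x | 0 ≤ u x} hρk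
  linarith
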